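/- Under the expected growth condition and the lower-rate condition, let α ≥ 0, ρ ≥ 0, and h ∈ B_g(E). Then for every x ∈ E and every relaxed control Θ ∈ V^r(x): −ρ·𝓛_α(x,Θ) + L_α f(x,Θ) + H_α r(x,Θ) + G_α h(x,Θ) ≥ −(ρ + b·‖h‖_g)·K_λ − ‖h‖_g·g(x). In particular, the relaxed one-stage value R_α(ρ,h)(x) := inf_{Θ ∈ V^r(x)} {−ρ·𝓛_α(x,Θ) + L_α f(x,Θ) + H_α r(x,Θ) + G_α h(x,Θ)} satisfies the same lower bound. -/

import Mathlib

open MeasureTheory ENNReal Set Filter Topology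

namespace PDMP

noncomputable section

/-- Data of a controlled PDMP: state space `E ⊆ ℝⁿ`, flow `φ`, feasible action sets `feas = 𝕌`,
jump rate `lam = λ` and transition kernel `Q`. -/
structure Setting (n : ℕ) (U : Type*) [MeasurableSpace U] where
  E : Set (Fin n → ℝ)
  φ : (Fin n → ℝ) → ℝ → (Fin n → ℝ)
  feas : (Fin n → ℝ) → Set U
  lam : (Fin n → ℝ) → U → ℝ
  Q : (Fin n → ℝ) → U → Measure (Fin n → ℝ)

/-- A relaxed control: a time component (measures on the action space along the flow) and a
boundary component. -/
structure RControl (U : Type*) [MeasurableSpace U] where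
  time : ℝ → Measure U
  bdry : Measure U

variable {n : ℕ} {U : Type*} [MeasurableSpace U]

namespace Setting

variable (S : Setting n U)

/-- The exit time `t*(x)` from `E`, valued in `[0,∞]` (`∞` if the flow never reaches `∂E`). -/
def ts (x : Fin n → ℝ) : ℝ≥0∞ :=
  sInf {T : ℝ≥0∞ | ∃ t : ℝ, 0 < t ∧ S.φ x t ∈ frontier S.E ∧ T = ENNReal.ofReal t}

/-- Real version of the exit time (junk value `0` when `t*(x) = ∞`). -/
def tsR (x : Fin n → ℝ) : ℝ := (S.ts x).toReal

/-- The time interval `[0, t*(x))` as a subset of `ℝ`. -/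
def fs (x : Fin n → ℝ) : Set ℝ := {t : ℝ | 0 ≤ t ∧ ENNReal.ofReal t < S.ts x}

/-- `λ(y,μ) = ∫ λ(y,u) μ(du)`, as an extended nonnegative real. -/
def lamMix (y : Fin n → ℝ) (m : Measure U) : ℝ≥0∞ := ∫⁻ u, ENNReal.ofReal (S.lam y u) ∂m

/-- `Q k (y,a) = ∫_E k(z) Q(y,a;dz)`. -/
def Qpt (k : (Fin n → ℝ) → ℝ≥0∞) (y : Fin n → ℝ) (a : U) : ℝ≥0∞ := ∫⁻ z in S.E, k z ∂(S.Q y a)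

/-- `Q k (y,μ) = ∫∫_E k(z) Q(y,u;dz) μ(du)`. -/
def QMix (k : (Fin n → ℝ) → ℝ≥0∞) (y : Fin n → ℝ) (m : Measure U) : ℝ≥0∞ :=
  ∫⁻ u, S.Qpt k y u ∂m

/-- `λQ k (y,μ) = ∫ λ(y,u) ∫_E k(z) Q(y,u;dz) μ(du)`. -/
def lamQMix (k : (Fin n → ℝ) → ℝ≥0∞) (y : Fin n → ℝ) (m : Measure U) : ℝ≥0∞ :=
  ∫⁻ u, ENNReal.ofReal (S.lam y u) * S.Qpt k y u ∂m

/-- `Λ^μ(x,t) = ∫_0^t λ(φ(x,s), μ(s)) ds`. -/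
def Lam (x : Fin n → ℝ) (Θ : RControl U) (t : ℝ) : ℝ≥0∞ :=
  ∫⁻ s in Set.Ioc (0 : ℝ) t, S.lamMix (S.φ x s) (Θ.time s)

/-- The integrating factor `e^{-α t - Λ^μ(x,t)}` (equal to `0` when `Λ^μ(x,t) = ∞`). -/
def weight (α : ℝ) (x : Fin n → ℝ) (Θ : RControl U) (t : ℝ) : ℝ≥0∞ :=
  if S.Lam x Θ t = ⊤ then 0 else ENNReal.ofReal (Real.exp (-(α * t) - (S.Lam x Θ t).toReal))

/-- `𝓛_α(x,Θ) = ∫_0^{t*(x)} e^{-α s - Λ^μ(x,s)} ds`. -/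
def curlyL (α : ℝ) (x : Fin n → ℝ) (Θ : RControl U) : ℝ≥0∞ :=
  ∫⁻ t in S.fs x, S.weight α x Θ t

/-- `L_α v(x,Θ) = ∫_0^{t*(x)} e^{-α s - Λ^μ(x,s)} v(φ(x,s), μ(s)) ds`. -/
def Lop (α : ℝ) (v : (Fin n → ℝ) → Measure U → ℝ≥0∞) (x : Fin n → ℝ) (Θ : RControl U) :
    ℝ≥0∞ :=
  ∫⁻ t in S.fs x, S.weight α x Θ t * v (S.φ x t) (Θ.time t)

/-- `H_α w(x,Θ) = e^{-α t*(x) - Λ^μ(x,t*(x))} w(φ(x,t*(x)), μ∂)` when `t*(x) < ∞`, else `0`. -/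
def Hop (α : ℝ) (p : (Fin n → ℝ) → Measure U → ℝ≥0∞) (x : Fin n → ℝ) (Θ : RControl U) :
    ℝ≥0∞ :=
  if S.ts x < ⊤ then S.weight α x Θ (S.tsR x) * p (S.φ x (S.tsR x)) Θ.bdry else 0

/-- `G_α k(x,Θ)` for nonnegative `k`. -/
def Gop (α : ℝ) (k : (Fin n → ℝ) → ℝ≥0∞) (x : Fin n → ℝ) (Θ : RControl U) : ℝ≥0∞ :=
  S.Lop α (fun y m => S.lamQMix k y m) x Θ + S.Hop α (fun y m => S.QMix k y m) x Θ

/-- `G_α h(x,Θ)` for signed `h`, as `G_α h⁺ - G_α h⁻` in the extended reals. -/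
def GopS (α : ℝ) (h : (Fin n → ℝ) → ℝ) (x : Fin n → ℝ) (Θ : RControl U) : EReal :=
  ((S.Gop α (fun z => ENNReal.ofReal (h z)) x Θ : ℝ≥0∞) : EReal)
    - ((S.Gop α (fun z => ENNReal.ofReal (-h z)) x Θ : ℝ≥0∞) : EReal)

/-- Admissibility of a relaxed control at `x`, i.e. membership in `V^r(x)`. -/
def IsRelaxed (x : Fin n → ℝ) (Θ : RControl U) : Prop :=
  Measurable Θ.time ∧ (∀ t, IsProbabilityMeasure (Θ.time t)) ∧
    (∀ᵐ t ∂(volume.restrict (S.fs x)), Θ.time t (S.feas (S.φ x t)) = 1) ∧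
    IsProbabilityMeasure Θ.bdry ∧
    (S.ts x < ⊤ → Θ.bdry (S.feas (S.φ x (S.tsR x))) = 1)

/-- The relaxed control `u_φ(x)` induced by a feedback selector `u`. -/
def feedback (u : (Fin n → ℝ) → U) (x : Fin n → ℝ) : RControl U :=
  ⟨fun t => Measure.dirac (u (S.φ x t)), Measure.dirac (u (S.φ x (S.tsR x)))⟩

/-- Ordinary feedback measurable selectors: `u(y) ∈ 𝕌(y)`. -/
def IsSelector (u : (Fin n → ℝ) → U) : Prop :=
  Measurable u ∧ ∀ y ∈ closure S.E, u y ∈ S.feas y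

/-- Membership of `v` in `M^ac(E)` with derivative `Xv` along the flow; boundary values of `v`
are the limits along the flow. -/
def MemMac (v Xv : (Fin n → ℝ) → ℝ) : Prop :=
  Measurable v ∧ Measurable Xv ∧
    (∀ x ∈ S.E, ∀ t ∈ S.fs x,
      IntervalIntegrable (fun s => Xv (S.φ x s)) volume 0 t ∧
        v (S.φ x t) - v x = ∫ s in (0 : ℝ)..t, Xv (S.φ x s)) ∧
    (∀ x ∈ S.E, S.ts x < ⊤ →
      Tendsto (fun t => v (S.φ x t)) (𝓝[<] S.tsR x) (𝓝 (v (S.φ x (S.tsR x)))))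

/-- The weighted supremum norm `‖h‖_g = sup_{x ∈ E} |h(x)|/g(x)`. -/
def gnorm (h g : (Fin n → ℝ) → ℝ) : ℝ := sSup ((fun x => |h x| / g x) '' S.E)

/-- Membership in `B_g(E)`. -/
def memBg (h g : (Fin n → ℝ) → ℝ) : Prop :=
  Measurable h ∧ BddAbove ((fun x => |h x| / g x) '' S.E)

/-- `v(y,μ) = ∫ v(y,u) μ(du)` for a nonnegative cost `v` on `Ē × U`, as a function of the
state and a measure on actions. -/
def mix (_S : Setting n U) (v : (Fin n → ℝ) → U → ℝ) : (Fin n → ℝ) → Measure U → ℝ≥0∞ :=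
  fun y m => ∫⁻ u, ENNReal.ofReal (v y u) ∂m

/-- The quantity `-ρ 𝓛_α(x,Θ) + L_α f(x,Θ) + H_α r(x,Θ) + G_α h(x,Θ)` appearing in the
one-stage optimization problems, valued in the extended reals. -/
def oneStage (α ρ : ℝ) (f r : (Fin n → ℝ) → U → ℝ) (h : (Fin n → ℝ) → ℝ) (x : Fin n → ℝ)
    (Θ : RControl U) : EReal :=
  (-(ρ : EReal)) * ((S.curlyL α x Θ : ℝ≥0∞) : EReal)
    + ((S.Lop α (S.mix f) x Θ : ℝ≥0∞) : EReal)
    + ((S.Hop α (S.mix r) x Θ : ℝ≥0∞) : EReal) + S.GopS α h x Θ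

end Setting

/-- The basic structural assumptions on the data of the control problem. -/
structure Basic [TopologicalSpace U] (S : Setting n U) : Prop where
  openE : IsOpen S.E
  nonemptyE : S.E.Nonempty
  contFlow : Continuous (Function.uncurry S.φ)
  flowZero : ∀ x, S.φ x 0 = x
  flowAdd : ∀ x s t, 0 ≤ s → 0 ≤ t → S.φ x (s + t) = S.φ (S.φ x s) t
  feasCompact : ∀ y ∈ closure S.E, IsCompact (S.feas y)
  feasNonempty : ∀ y ∈ closure S.E, (S.feas y).Nonempty
  lamMeas : Measurable (Function.uncurry S.lam)
  lamNonneg : ∀ y ∈ closure S.E, ∀ u, 0 ≤ S.lam y u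
  Qprob : ∀ y u, IsProbabilityMeasure (S.Q y u)
  QsuppE : ∀ y u, S.Q y u S.E = 1
  Qmeas : Measurable fun p : (Fin n → ℝ) × U => S.Q p.1 p.2

/-- The expected growth condition (Assumption 3.1 of the paper, inequalities (Cu1)/(Cu2)). -/
structure ExpGrowth (S : Setting n U) (b c : ℝ) (g Xg rbar : (Fin n → ℝ) → ℝ) : Prop where
  b_nonneg : 0 ≤ b
  c_pos : 0 < c
  g_ge_one : ∀ y, 1 ≤ g y
  g_mac : S.MemMac g Xg
  rbar_meas : Measurable rbar
  rbar_nonneg : ∀ z ∈ frontier S.E, 0 ≤ rbar z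
  drift : ∀ x ∈ S.E, ∀ a ∈ S.feas x,
    ((Xg x + c * g x : ℝ) : EReal)
        + ((ENNReal.ofReal (S.lam x a) * S.Qpt (fun z => ENNReal.ofReal (g z)) x a : ℝ≥0∞) :
            EReal)
      ≤ ((b + S.lam x a * g x : ℝ) : EReal)
  bdryGrowth : ∀ x ∈ S.E, S.ts x < ⊤ → ∀ a ∈ S.feas (S.φ x (S.tsR x)),
    ENNReal.ofReal (rbar (S.φ x (S.tsR x)))
        + S.Qpt (fun z => ENNReal.ofReal (g z)) (S.φ x (S.tsR x)) a
      ≤ ENNReal.ofReal (g (S.φ x (S.tsR x)))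

/-- The full expected growth condition: the bounds on the running and boundary costs
(inequalities (Cu3)/(Cu3a) of Assumption 3.1 of the paper). -/
structure CostBound (S : Setting n U) (c δ M : ℝ) (g rbar : (Fin n → ℝ) → ℝ)
    (f r : (Fin n → ℝ) → U → ℝ) : Prop where
  δ_pos : 0 < δ
  M_nonneg : 0 ≤ M
  f_meas : Measurable (Function.uncurry f)
  f_nonneg : ∀ y ∈ closure S.E, ∀ u, 0 ≤ f y u
  r_meas : Measurable (Function.uncurry r)
  r_nonneg : ∀ z ∈ frontier S.E, ∀ u, 0 ≤ r z u
  f_bound : ∀ x ∈ S.E, ∀ a ∈ S.feas x, f x a ≤ M * g x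
  r_bound : ∀ x ∈ S.E, S.ts x < ⊤ → ∀ a ∈ S.feas (S.φ x (S.tsR x)),
    r (S.φ x (S.tsR x)) a ≤ M / (c + δ) * rbar (S.φ x (S.tsR x))

/-- The lower-rate condition (parts of Assumptions 3.2 and 3.7 of the paper). -/
structure LowerRate (S : Setting n U) (c : ℝ) (lamL : (Fin n → ℝ) → ℝ) (Kl : ℝ) : Prop where
  lamL_meas : Measurable lamL
  lamL_nonneg : ∀ y, 0 ≤ lamL y
  Kl_nonneg : 0 ≤ Kl
  lam_ge : ∀ y ∈ S.E, ∀ a ∈ S.feas y, lamL y ≤ S.lam y a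
  lamL_locInt : ∀ x ∈ S.E, ∀ t ∈ S.fs x,
    IntervalIntegrable (fun s => lamL (S.φ x s)) volume 0 t
  lamL_intTs : ∀ x ∈ S.E, S.ts x < ⊤ →
    IntervalIntegrable (fun s => lamL (S.φ x s)) volume 0 (S.tsR x)
  intBound : ∀ x ∈ S.E,
    (∫⁻ t in S.fs x,
        ENNReal.ofReal (Real.exp (c * t - ∫ s in (0 : ℝ)..t, lamL (S.φ x s))))
      ≤ ENNReal.ofReal Kl
  supInt : ∀ x ∈ S.E, ∀ t ∈ S.fs x,
    (∫⁻ s in Set.Ioc (0 : ℝ) t, ⨆ a ∈ S.feas (S.φ x s), ENNReal.ofReal (S.lam (S.φ x s) a)) < ⊤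
  supIntTs : ∀ x ∈ S.E, S.ts x < ⊤ →
    (∫⁻ s in Set.Ioc (0 : ℝ) (S.tsR x),
        ⨆ a ∈ S.feas (S.φ x s), ENNReal.ofReal (S.lam (S.φ x s) a)) < ⊤

end

end PDMP

open PDMP MeasureTheory ENNReal Set Filter Topology



lemma ac_ibp {T : ℝ} (hT : 0 ≤ T) {A X : ℝ → ℝ} (hA : IntervalIntegrable A volume 0 T)
    (hX : IntervalIntegrable X volume 0 T) (hA0 : ∀ s, 0 ≤ A s) (G0 : ℝ) :
    ∫ s in (0:ℝ)..T, Real.exp (-∫ u in (0:ℝ)..s, A u) * (X s - A s * (G0 + ∫ u in (0:ℝ)..s, X u))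
      = Real.exp (-∫ u in (0:ℝ)..T, A u) * (G0 + ∫ u in (0:ℝ)..T, X u) - G0 := by
  have hP := hA.absolutelyContinuousOnInterval_intervalIntegral (c := 0) (by simp)
  have hY := hX.absolutelyContinuousOnInterval_intervalIntegral (c := 0) (by simp)
  have hE : AbsolutelyContinuousOnInterval (fun s => Real.exp (-∫ u in (0:ℝ)..s, A u)) 0 T := by
    rw [absolutelyContinuousOnInterval_iff] at hP ⊢
    intro ε hε
    obtain ⟨δ, hδ, H⟩ := hP ε hε
    refine ⟨δ, hδ, fun I hI hs => lt_of_le_of_lt (Finset.sum_le_sum fun i hi => ?_) (H I hI hs)⟩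
    have h1 := (hI.1 i hi).1
    have h2 := (hI.1 i hi).2
    rw [uIcc_of_le hT] at h1 h2
    have p1 : 0 ≤ ∫ u in (0:ℝ)..(I.2 i).1, A u :=
      intervalIntegral.integral_nonneg h1.1 fun u _ => hA0 u
    have p2 : 0 ≤ ∫ u in (0:ℝ)..(I.2 i).2, A u :=
      intervalIntegral.integral_nonneg h2.1 fun u _ => hA0 u
    generalize (∫ u in (0:ℝ)..(I.2 i).1, A u) = a at *
    generalize (∫ u in (0:ℝ)..(I.2 i).2, A u) = b at *
    have key : ∀ a b : ℝ, 0 ≤ a → a ≤ b → Real.exp (-a) - Real.exp (-b) ≤ b - a := by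
      intro a b ha hab
      have e1 : Real.exp (-b) = Real.exp (-a) * Real.exp (a - b) := by
        rw [← Real.exp_add]; ring_nf
      have e2 := Real.add_one_le_exp (a - b)
      have e3 : Real.exp (-a) ≤ 1 := Real.exp_le_one_iff.2 (by linarith)
      have e4 := Real.exp_pos (-a)
      rw [e1]
      nlinarith
    rw [Real.dist_eq, Real.dist_eq]
    rcases le_total a b with hab | hab
    · have := key a b p1 hab
      rw [abs_of_nonneg (sub_nonneg.2 (Real.exp_le_exp.2 (by linarith))), abs_sub_comm,
        abs_of_nonneg (by linarith)]
      exact this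
    · have := key b a p2 hab
      rw [abs_sub_comm, abs_of_nonneg (sub_nonneg.2 (Real.exp_le_exp.2 (by linarith))),
        abs_of_nonneg (by linarith)]
      exact this
  have hG : AbsolutelyContinuousOnInterval (fun s => G0 + ∫ u in (0:ℝ)..s, X u) 0 T :=
    (LipschitzOnWith.absolutelyContinuousOnInterval
      (LipschitzWith.const G0).lipschitzOnWith).add hY
  have := hE.integral_deriv_mul_eq_sub hG
  simp only [intervalIntegral.integral_same, neg_zero, Real.exp_zero, add_zero, one_mul] at this
  rw [← this]
  apply intervalIntegral.integral_congr_ae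
  filter_upwards [hA.ae_hasDerivAt_integral, hX.ae_hasDerivAt_integral] with s h1 h2 hs
  have hs' := uIoc_subset_uIcc hs
  have d1 := (h1 hs' 0 (by simp)).neg.exp
  have d2 := (h2 hs' 0 (by simp)).const_add G0
  rw [d2.deriv]
  erw [d1.deriv]
  simp only [Pi.neg_apply]
  ring

section helpers
set_option linter.unusedSectionVars false
variable {n : ℕ} {U : Type*} [MeasurableSpace U]

lemma fs_sub (S : Setting n U) {x : Fin n → ℝ} {T : ℝ} (hT : T ∈ S.fs x) : Icc 0 T ⊆ S.fs x :=
  fun _ ht => ⟨ht.1, lt_of_le_of_lt (ENNReal.ofReal_le_ofReal ht.2) hT.2⟩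

lemma flow_mem [TopologicalSpace U] (S : Setting n U) (hS : Basic S) {x : Fin n → ℝ} (hx : x ∈ S.E)
    {T : ℝ} (hT : T ∈ S.fs x) : S.φ x T ∈ S.E := by
  have hc : Continuous (fun t => S.φ x t) := hS.contFlow.comp (by fun_prop : Continuous fun t : ℝ => (x, t))
  have hnf : ∀ t ∈ Icc 0 T, S.φ x t ∉ frontier S.E := by
    intro t ht hf
    rcases eq_or_lt_of_le ht.1 with h0 | h0
    · rw [← h0, hS.flowZero] at hf
      rw [hS.openE.frontier_eq] at hf
      exact hf.2 hx
    · have h1 : S.ts x ≤ ENNReal.ofReal t := sInf_le ⟨t, h0, hf, rfl⟩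
      exact absurd (fs_sub S hT ht).2 (not_lt.2 h1)
  have hpc : IsPreconnected ((fun t => S.φ x t) '' Icc 0 T) :=
    isPreconnected_Icc.image _ hc.continuousOn
  have hsub : ((fun t => S.φ x t) '' Icc 0 T) ⊆ S.E := by
    refine IsPreconnected.subset_left_of_subset_union hS.openE
      (isClosed_closure (s := S.E)).isOpen_compl
      (disjoint_compl_right_iff_subset.2 subset_closure) ?_
      ⟨x, ⟨0, ⟨le_rfl, hT.1⟩, hS.flowZero x⟩, hx⟩ hpc
    rintro _ ⟨t, ht, rfl⟩
    by_contra hn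
    rw [mem_union, not_or, mem_compl_iff, not_not] at hn
    exact hnf t ht (by rw [hS.openE.frontier_eq]; exact ⟨hn.2, hn.1⟩)
  exact hsub ⟨T, ⟨hT.1, le_rfl⟩, rfl⟩

lemma ts_pos [TopologicalSpace U] (S : Setting n U) (hS : Basic S) {x : Fin n → ℝ} (hx : x ∈ S.E) :
    0 < S.ts x := by
  have hc : Continuous (fun t => S.φ x t) := hS.contFlow.comp (by fun_prop : Continuous fun t : ℝ => (x, t))
  have h0 : (fun t => S.φ x t) ⁻¹' S.E ∈ 𝓝 (0:ℝ) :=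
    (hS.openE.preimage hc).mem_nhds (by simpa [hS.flowZero] using hx)
  obtain ⟨ε, hε, hb⟩ := Metric.mem_nhds_iff.1 h0
  refine lt_of_lt_of_le (ENNReal.ofReal_pos.2 hε) (le_sInf ?_)
  rintro _ ⟨t, ht, hf, rfl⟩
  apply ENNReal.ofReal_le_ofReal
  by_contra hlt
  have : t ∈ Metric.ball (0:ℝ) ε := by
    rw [Metric.mem_ball, Real.dist_eq, sub_zero, abs_of_pos ht]; exact not_le.1 hlt
  rw [hS.openE.frontier_eq] at hf
  exact hf.2 (hb this)

lemma mem_fs_iff (S : Setting n U) {x : Fin n → ℝ} (h : S.ts x < ⊤) (t : ℝ) :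
    t ∈ S.fs x ↔ 0 ≤ t ∧ t < S.tsR x := by
  constructor
  · rintro ⟨a, b⟩
    exact ⟨a, (ENNReal.ofReal_lt_iff_lt_toReal a h.ne).1 b⟩
  · rintro ⟨a, b⟩
    exact ⟨a, (ENNReal.ofReal_lt_iff_lt_toReal a h.ne).2 b⟩

lemma tsR_pos [TopologicalSpace U] (S : Setting n U) (hS : Basic S) {x : Fin n → ℝ} (hx : x ∈ S.E)
    (h : S.ts x < ⊤) : 0 < S.tsR x := ENNReal.toReal_pos (ts_pos S hS hx).ne' h.ne

lemma fs_union [TopologicalSpace U] (S : Setting n U) (hS : Basic S) {x : Fin n → ℝ} (hx : x ∈ S.E) :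
    ∃ T : ℕ → ℝ, Monotone T ∧ (∀ k, T k ∈ S.fs x) ∧ S.fs x = ⋃ k, Icc 0 (T k) := by
  by_cases h : S.ts x < ⊤
  · obtain ⟨u, hu, hm, ht⟩ := exists_seq_strictMono_tendsto' (tsR_pos S hS hx h)
    have hmem : ∀ k, u k ∈ S.fs x := fun k => (mem_fs_iff S h _).2 ⟨(hm k).1.le, (hm k).2⟩
    refine ⟨u, hu.monotone, hmem, Subset.antisymm ?_ (iUnion_subset fun k => fs_sub S (hmem k))⟩
    intro t hts
    have := (mem_fs_iff S h _).1 hts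
    obtain ⟨k, hk⟩ := (ht.eventually (lt_mem_nhds this.2)).exists
    exact mem_iUnion.2 ⟨k, this.1, hk.le⟩
  · have h' : S.ts x = ⊤ := by simpa using h
    have hmem : ∀ k : ℕ, (k : ℝ) ∈ S.fs x := fun k => ⟨by positivity, by rw [h']; exact ENNReal.ofReal_lt_top⟩
    refine ⟨fun k => k, Nat.mono_cast, hmem, Subset.antisymm ?_ (iUnion_subset fun k => fs_sub S (hmem k))⟩
    intro t hts
    obtain ⟨k, hk⟩ := exists_nat_ge t
    exact mem_iUnion.2 ⟨k, hts.1, hk⟩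

lemma lint_fs [TopologicalSpace U] (S : Setting n U) (hS : Basic S) {x : Fin n → ℝ} (hx : x ∈ S.E)
    (F : ℝ → ℝ≥0∞) : ∃ T : ℕ → ℝ, (∀ k, T k ∈ S.fs x) ∧
      ∫⁻ t in S.fs x, F t = ⨆ k, ∫⁻ t in Icc 0 (T k), F t := by
  obtain ⟨T, hm, hT, hU⟩ := fs_union S hS hx
  refine ⟨T, hT, ?_⟩
  rw [hU, setLIntegral_iUnion_of_directed]
  exact directed_of_isDirected_le fun i j hij => Icc_subset_Icc_right (hm hij)

lemma ae_feas_of_one {m : Measure U} [IsProbabilityMeasure m] {A : Set U} (hA : MeasurableSet A)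
    (h : m A = 1) : ∀ᵐ u ∂m, u ∈ A := by
  rw [ae_iff]
  exact (prob_compl_eq_zero_iff hA).2 h

variable [MetricSpace U] [CompactSpace U] [BorelSpace U]

lemma ae_feas (S : Setting n U) (hS : Basic S) {x : Fin n → ℝ} (hx : x ∈ S.E)
    {Θ : RControl U} (hΘ : S.IsRelaxed x Θ) :
    ∀ᵐ s ∂(volume.restrict (S.fs x)), S.φ x s ∈ S.E ∧ ∀ᵐ u ∂(Θ.time s), u ∈ S.feas (S.φ x s) := by
  obtain ⟨T, hm, hT, hU⟩ := fs_union S hS hx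
  have hmeas : MeasurableSet (S.fs x) := by
    rw [hU]; exact MeasurableSet.iUnion fun k => measurableSet_Icc
  filter_upwards [hΘ.2.2.1, ae_restrict_mem hmeas] with s h1 hs
  have hE := flow_mem S hS hx hs
  have := hΘ.2.1 s
  exact ⟨hE, ae_feas_of_one (hS.feasCompact _ (subset_closure hE)).isClosed.measurableSet h1⟩

lemma ae_feas_Icc (S : Setting n U) (hS : Basic S) {x : Fin n → ℝ} (hx : x ∈ S.E)
    {Θ : RControl U} (hΘ : S.IsRelaxed x Θ) {T : ℝ} (hT : T ∈ S.fs x) :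
    ∀ᵐ s ∂(volume.restrict (Icc 0 T)), S.φ x s ∈ S.E ∧ ∀ᵐ u ∂(Θ.time s), u ∈ S.feas (S.φ x s) :=
  ae_restrict_of_ae_restrict_of_subset (fs_sub S hT) (ae_feas S hS hx hΘ)

lemma Lam_lt_top (S : Setting n U) (hS : Basic S) {c Kl : ℝ} {lamL : (Fin n → ℝ) → ℝ}
    (hLR : LowerRate S c lamL Kl) {x : Fin n → ℝ} (hx : x ∈ S.E)
    {Θ : RControl U} (hΘ : S.IsRelaxed x Θ) {T : ℝ} (hT : T ∈ S.fs x) : S.Lam x Θ T < ⊤ := by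
  refine lt_of_le_of_lt ?_ (hLR.supInt x hx T hT)
  apply lintegral_mono_ae
  filter_upwards [ae_restrict_of_ae_restrict_of_subset Ioc_subset_Icc_self
    (ae_feas_Icc S hS hx hΘ hT)] with s hs
  have := hΘ.2.1 s
  calc S.lamMix (S.φ x s) (Θ.time s)
      ≤ ∫⁻ _, (⨆ a ∈ S.feas (S.φ x s), ENNReal.ofReal (S.lam (S.φ x s) a)) ∂(Θ.time s) := by
        apply lintegral_mono_ae
        filter_upwards [hs.2] with u hu
        exact le_iSup₂ (f := fun a _ => ENNReal.ofReal (S.lam (S.φ x s) a)) u hu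
    _ = _ := by simp

lemma lamMix_meas (S : Setting n U) (hS : Basic S) {x : Fin n → ℝ}
    {Θ : RControl U} (hΘ : S.IsRelaxed x Θ) :
    Measurable fun s => S.lamMix (S.φ x s) (Θ.time s) := by
  have hc : Continuous (fun t => S.φ x t) := hS.contFlow.comp (by fun_prop : Continuous fun t : ℝ => (x, t))
  let κ : ProbabilityTheory.Kernel ℝ U := ⟨Θ.time, hΘ.1⟩
  have : ProbabilityTheory.IsMarkovKernel κ := ⟨hΘ.2.1⟩
  have hm : Measurable fun p : ℝ × U => ENNReal.ofReal (S.lam (S.φ x p.1) p.2) :=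
    (hS.lamMeas.comp ((hc.measurable.comp measurable_fst).prodMk measurable_snd)).ennreal_ofReal
  exact Measurable.lintegral_kernel_prod_right' (κ := κ) hm

lemma Lam_facts (S : Setting n U) (hS : Basic S) {c Kl : ℝ} {lamL : (Fin n → ℝ) → ℝ}
    (hLR : LowerRate S c lamL Kl) {x : Fin n → ℝ} (hx : x ∈ S.E)
    {Θ : RControl U} (hΘ : S.IsRelaxed x Θ) {T : ℝ} (hT : T ∈ S.fs x) :
    IntervalIntegrable (fun s => (S.lamMix (S.φ x s) (Θ.time s)).toReal) volume 0 T ∧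
    (∀ᵐ s ∂(volume.restrict (Ioc 0 T)), S.lamMix (S.φ x s) (Θ.time s) < ⊤) ∧
    ∫ s in (0:ℝ)..T, (S.lamMix (S.φ x s) (Θ.time s)).toReal = (S.Lam x Θ T).toReal := by
  have hf := Lam_lt_top S hS hLR hx hΘ hT
  have hm := lamMix_meas S hS hΘ
  have hae := ae_lt_top hm hf.ne
  refine ⟨?_, hae, ?_⟩
  · rw [intervalIntegrable_iff_integrableOn_Ioc_of_le hT.1]
    exact integrable_toReal_of_lintegral_ne_top hm.aemeasurable hf.ne
  · rw [intervalIntegral.integral_of_le hT.1, integral_toReal hm.aemeasurable hae]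
    rfl

lemma weight_eq (S : Setting n U) (hS : Basic S) {c Kl : ℝ} {lamL : (Fin n → ℝ) → ℝ}
    (hLR : LowerRate S c lamL Kl) {x : Fin n → ℝ} (hx : x ∈ S.E)
    {Θ : RControl U} (hΘ : S.IsRelaxed x Θ) {T : ℝ} (hT : T ∈ S.fs x) (α : ℝ) :
    S.weight α x Θ T = ENNReal.ofReal (Real.exp
      (-∫ s in (0:ℝ)..T, (α + (S.lamMix (S.φ x s) (Θ.time s)).toReal))) := by
  have hf := Lam_lt_top S hS hLR hx hΘ hT
  obtain ⟨h1, _, h3⟩ := Lam_facts S hS hLR hx hΘ hT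
  rw [Setting.weight, if_neg hf.ne, intervalIntegral.integral_add (by simp) h1, h3]
  simp only [intervalIntegral.integral_const, smul_eq_mul]
  congr 2; ring

lemma weight_anti (S : Setting n U) {x : Fin n → ℝ} (Θ : RControl U) {α : ℝ} (hα : 0 ≤ α)
    {s t : ℝ} (hst : s ≤ t) : S.weight α x Θ t ≤ S.weight α x Θ s := by
  have hL : S.Lam x Θ s ≤ S.Lam x Θ t := lintegral_mono_set (Ioc_subset_Ioc_right hst)
  unfold Setting.weight
  by_cases ht : S.Lam x Θ t = ⊤
  · simp [ht]
  · have hs : S.Lam x Θ s ≠ ⊤ := ne_top_of_le_ne_top ht hL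
    rw [if_neg ht, if_neg hs]
    apply ENNReal.ofReal_le_ofReal
    apply Real.exp_le_exp.2
    have := ENNReal.toReal_mono ht hL
    nlinarith

lemma weight_le (S : Setting n U) (hS : Basic S) {c Kl : ℝ} (hc : 0 < c) {lamL : (Fin n → ℝ) → ℝ}
    (hLR : LowerRate S c lamL Kl) {x : Fin n → ℝ} (hx : x ∈ S.E)
    {Θ : RControl U} (hΘ : S.IsRelaxed x Θ) {T : ℝ} (hT : T ∈ S.fs x) {α : ℝ} (hα : 0 ≤ α) :
    S.weight α x Θ T ≤ ENNReal.ofReal (Real.exp (c * T - ∫ s in (0:ℝ)..T, lamL (S.φ x s))) := by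
  have hf := Lam_lt_top S hS hLR hx hΘ hT
  rw [Setting.weight, if_neg hf.ne]
  apply ENNReal.ofReal_le_ofReal
  apply Real.exp_le_exp.2
  have hT0 := hT.1
  have : ∫ s in (0:ℝ)..T, lamL (S.φ x s) ≤ (S.Lam x Θ T).toReal := by
    obtain ⟨h1, h2, h3⟩ := Lam_facts S hS hLR hx hΘ hT
    rw [← h3]
    rw [intervalIntegral.integral_of_le hT0, intervalIntegral.integral_of_le hT0]
    apply integral_mono_ae
    · exact (intervalIntegrable_iff_integrableOn_Ioc_of_le hT0).1 (hLR.lamL_locInt x hx T hT)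
    · exact (intervalIntegrable_iff_integrableOn_Ioc_of_le hT0).1 h1
    filter_upwards [h2, ae_restrict_of_ae_restrict_of_subset Ioc_subset_Icc_self
      (ae_feas_Icc S hS hx hΘ hT)] with s hs1 hs2
    have := hΘ.2.1 s
    rw [← ENNReal.ofReal_le_iff_le_toReal hs1.ne]
    calc ENNReal.ofReal (lamL (S.φ x s)) = ∫⁻ _, ENNReal.ofReal (lamL (S.φ x s)) ∂(Θ.time s) := by simp
      _ ≤ _ := by
        apply lintegral_mono_ae
        filter_upwards [hs2.2] with u hu
        exact ENNReal.ofReal_le_ofReal (hLR.lam_ge _ hs2.1 u hu)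
  nlinarith [mul_nonneg hα hT0, mul_nonneg hc.le hT0]

lemma curlyL_le (S : Setting n U) (hS : Basic S) {c Kl : ℝ} (hc : 0 < c) {lamL : (Fin n → ℝ) → ℝ}
    (hLR : LowerRate S c lamL Kl) {x : Fin n → ℝ} (hx : x ∈ S.E)
    {Θ : RControl U} (hΘ : S.IsRelaxed x Θ) {α : ℝ} (hα : 0 ≤ α) :
    S.curlyL α x Θ ≤ ENNReal.ofReal Kl := by
  refine le_trans ?_ (hLR.intBound x hx)
  obtain ⟨T, hm, hT, hU⟩ := fs_union S hS hx
  have hmeas : MeasurableSet (S.fs x) := by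
    rw [hU]; exact MeasurableSet.iUnion fun k => measurableSet_Icc
  exact setLIntegral_mono' hmeas fun t ht => weight_le S hS hc hLR hx hΘ ht hα

lemma drift_mix (S : Setting n U) (hS : Basic S) {b c : ℝ} {g Xg rbar : (Fin n → ℝ) → ℝ}
    (hEG : ExpGrowth S b c g Xg rbar) {y : Fin n → ℝ} (hy : y ∈ S.E) (m : Measure U)
    [IsProbabilityMeasure m] (hm : ∀ᵐ u ∂m, u ∈ S.feas y) (hl : S.lamMix y m < ⊤) :
    S.lamQMix (fun z => ENNReal.ofReal (g z)) y m
        ≤ ENNReal.ofReal (b - Xg y - c * g y + (S.lamMix y m).toReal * g y) ∧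
      0 ≤ b - Xg y - c * g y + (S.lamMix y m).toReal * g y := by
  have hmeas : Measurable fun u => S.lam y u := hS.lamMeas.comp measurable_prodMk_left
  have hnn : ∀ u, 0 ≤ S.lam y u := hS.lamNonneg y (subset_closure hy)
  have hint : Integrable (fun u => S.lam y u) m := by
    refine ⟨hmeas.aestronglyMeasurable, ?_⟩
    rw [hasFiniteIntegral_iff_ofReal (Eventually.of_forall hnn)]
    exact hl
  have hval : ∫ u, S.lam y u ∂m = (S.lamMix y m).toReal :=
    integral_eq_lintegral_of_nonneg_ae (Eventually.of_forall hnn) hmeas.aestronglyMeasurable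
  have hpt : ∀ᵐ u ∂m, 0 ≤ (b - Xg y - c * g y) + S.lam y u * g y ∧
      ENNReal.ofReal (S.lam y u) * S.Qpt (fun z => ENNReal.ofReal (g z)) y u
        ≤ ENNReal.ofReal ((b - Xg y - c * g y) + S.lam y u * g y) := by
    filter_upwards [hm] with u hu
    have hd := hEG.drift y hy u hu
    generalize ENNReal.ofReal (S.lam y u) * S.Qpt (fun z => ENNReal.ofReal (g z)) y u = q at hd ⊢
    have hq : q ≠ ⊤ := by
      rintro rfl
      rw [EReal.coe_ennreal_top, EReal.coe_add_top] at hd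
      exact absurd (lt_of_le_of_lt hd (EReal.coe_lt_top _)) (lt_irrefl _)
    lift q to NNReal using hq
    have hqq : ((q : ℝ≥0∞) : EReal) = ((q : ℝ) : EReal) := rfl
    rw [hqq] at hd
    have hd' : Xg y + c * g y + (q : ℝ) ≤ b + S.lam y u * g y := by exact_mod_cast hd
    have hq0 := q.2
    refine ⟨by linarith [show (0:ℝ) ≤ q from hq0], ?_⟩
    rw [← ENNReal.ofReal_coe_nnreal]
    exact ENNReal.ofReal_le_ofReal (by linarith)
  have hint2 : Integrable (fun u => (b - Xg y - c * g y) + S.lam y u * g y) m :=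
    (integrable_const _).add (hint.mul_const _)
  have hval2 : ∫ u, ((b - Xg y - c * g y) + S.lam y u * g y) ∂m
      = b - Xg y - c * g y + (S.lamMix y m).toReal * g y := by
    rw [integral_add (integrable_const _) (hint.mul_const _), integral_mul_const, hval]
    simp
  constructor
  · rw [← hval2, ofReal_integral_eq_lintegral_ofReal hint2 (hpt.mono fun u hu => hu.1)]
    exact lintegral_mono_ae (hpt.mono fun u hu => hu.2)
  · rw [← hval2]
    exact integral_nonneg_of_ae (hpt.mono fun u hu => hu.1)

end helpers

section main
set_option linter.unusedSectionVars false
variable {n : ℕ} {U : Type*} [MeasurableSpace U] [MetricSpace U] [CompactSpace U] [BorelSpace U]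

lemma main_T (S : Setting n U) (hS : Basic S) {b c Kl : ℝ} {g Xg rbar lamL : (Fin n → ℝ) → ℝ}
    (hEG : ExpGrowth S b c g Xg rbar) (hLR : LowerRate S c lamL Kl) {x : Fin n → ℝ} (hx : x ∈ S.E)
    {Θ : RControl U} (hΘ : S.IsRelaxed x Θ) {T : ℝ} (hT : T ∈ S.fs x) {α : ℝ} (hα : 0 ≤ α) :
    (∫⁻ t in Icc 0 T, S.weight α x Θ t *
        S.lamQMix (fun z => ENNReal.ofReal (g z)) (S.φ x t) (Θ.time t))
      + S.weight α x Θ T * ENNReal.ofReal (g (S.φ x T))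
      ≤ ENNReal.ofReal (g x) + ENNReal.ofReal b * ∫⁻ t in Icc 0 T, S.weight α x Θ t := by
  have hT0 := hT.1
  obtain ⟨hA', hfin, _⟩ := Lam_facts S hS hLR hx hΘ hT
  set A : ℝ → ℝ := fun s => α + (S.lamMix (S.φ x s) (Θ.time s)).toReal with hAdef
  have hA : IntervalIntegrable A volume 0 T := (by simp : IntervalIntegrable (fun _ : ℝ => α) volume 0 T).add hA'
  have hA0 : ∀ s, 0 ≤ A s := fun s => add_nonneg hα ENNReal.toReal_nonneg
  have hX : IntervalIntegrable (fun s => Xg (S.φ x s)) volume 0 T := (hEG.g_mac.2.2.1 x hx T hT).1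
  have hG : ∀ t ∈ Icc 0 T, g x + ∫ s in (0:ℝ)..t, Xg (S.φ x s) = g (S.φ x t) := by
    intro t ht
    rw [← (hEG.g_mac.2.2.1 x hx t (fs_sub S hT ht)).2]; ring
  set w : ℝ → ℝ := fun t => Real.exp (-∫ s in (0:ℝ)..t, A s) with hwdef
  have hw : ∀ t ∈ Icc 0 T, S.weight α x Θ t = ENNReal.ofReal (w t) := fun t ht =>
    weight_eq S hS hLR hx hΘ (fs_sub S hT ht) α
  have hwpos : ∀ t, 0 < w t := fun t => Real.exp_pos _
  have hwc : ContinuousOn w (uIcc 0 T) :=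
    ((hA.absolutelyContinuousOnInterval_intervalIntegral (c := 0) (by simp)).continuousOn.neg).rexp
  set G : ℝ → ℝ := fun t => g x + ∫ s in (0:ℝ)..t, Xg (S.φ x s) with hGdef
  have hGc : ContinuousOn G (uIcc 0 T) :=
    continuousOn_const.add
      (hX.absolutelyContinuousOnInterval_intervalIntegral (c := 0) (by simp)).continuousOn
  have hibp : ∫ s in (0:ℝ)..T, w s * (Xg (S.φ x s) - A s * G s) = w T * G T - g x :=
    ac_ibp hT0 hA hX hA0 (g x)
  have hi1 : IntervalIntegrable (fun s => w s * (Xg (S.φ x s) - A s * G s)) volume 0 T :=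
    (hX.sub (hA.mul_continuousOn hGc)).continuousOn_mul hwc
  have hi2 : IntervalIntegrable w volume 0 T := hwc.intervalIntegrable
  have hi3 : IntervalIntegrable (fun s => b * w s - w s * (Xg (S.φ x s) - A s * G s)) volume 0 T :=
    (hi2.const_mul b).sub hi1
  have hJ : ∫ s in (0:ℝ)..T, (b * w s - w s * (Xg (S.φ x s) - A s * G s))
      = b * (∫ s in (0:ℝ)..T, w s) - (w T * G T - g x) := by
    rw [intervalIntegral.integral_sub (hi2.const_mul b) hi1, hibp, intervalIntegral.integral_const_mul]
  have hIcc : (volume : Measure ℝ).restrict (Icc 0 T) = volume.restrict (Ioc 0 T) :=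
    restrict_Ioc_eq_restrict_Icc.symm
  have hpt : ∀ᵐ s ∂(volume.restrict (Ioc 0 T)),
      0 ≤ b * w s - w s * (Xg (S.φ x s) - A s * G s) ∧
      S.weight α x Θ s * S.lamQMix (fun z => ENNReal.ofReal (g z)) (S.φ x s) (Θ.time s)
        ≤ ENNReal.ofReal (b * w s - w s * (Xg (S.φ x s) - A s * G s)) := by
    filter_upwards [hfin, ae_restrict_mem measurableSet_Ioc,
      ae_restrict_of_ae_restrict_of_subset Ioc_subset_Icc_self (ae_feas_Icc S hS hx hΘ hT)]
      with s h1 h2 h3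
    have hs : s ∈ Icc 0 T := Ioc_subset_Icc_self h2
    have := hΘ.2.1 s
    obtain ⟨d1, d2⟩ := drift_mix S hS hEG h3.1 (Θ.time s) h3.2 h1
    have hGs : G s = g (S.φ x s) := hG s hs
    have hg1 := hEG.g_ge_one (S.φ x s)
    have hcp := hEG.c_pos
    have hle : b - Xg (S.φ x s) - c * g (S.φ x s)
        + (S.lamMix (S.φ x s) (Θ.time s)).toReal * g (S.φ x s)
        ≤ b - (Xg (S.φ x s) - A s * G s) := by
      rw [hGs, hAdef]
      have : 0 ≤ (c + α) * g (S.φ x s) := by positivity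
      nlinarith [mul_nonneg hα (by linarith : 0 ≤ g (S.φ x s)), mul_nonneg hcp.le (by linarith : 0 ≤ g (S.φ x s))]
    have hfac : b * w s - w s * (Xg (S.φ x s) - A s * G s)
        = w s * (b - (Xg (S.φ x s) - A s * G s)) := by ring
    rw [hfac]
    refine ⟨mul_nonneg (hwpos s).le (d2.trans hle), ?_⟩
    rw [hw s hs, ENNReal.ofReal_mul (hwpos s).le]
    gcongr
    exact d1.trans (ENNReal.ofReal_le_ofReal hle)
  have hwint : ∫⁻ t in Icc 0 T, S.weight α x Θ t = ENNReal.ofReal (∫ s in (0:ℝ)..T, w s) := by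
    rw [setLIntegral_congr_fun measurableSet_Icc hw, hIcc, intervalIntegral.integral_of_le hT0,
      ofReal_integral_eq_lintegral_ofReal
        ((intervalIntegrable_iff_integrableOn_Ioc_of_le hT0).1 hi2)
        (Eventually.of_forall fun s => (hwpos s).le)]
  have hlhs : (∫⁻ t in Icc 0 T, S.weight α x Θ t *
        S.lamQMix (fun z => ENNReal.ofReal (g z)) (S.φ x t) (Θ.time t))
      ≤ ENNReal.ofReal (b * (∫ s in (0:ℝ)..T, w s) - (w T * G T - g x)) := by
    rw [← hJ, intervalIntegral.integral_of_le hT0, ofReal_integral_eq_lintegral_ofReal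
        ((intervalIntegrable_iff_integrableOn_Ioc_of_le hT0).1 hi3)
        (hpt.mono fun s hs => hs.1), hIcc]
    exact lintegral_mono_ae (hpt.mono fun s hs => hs.2)
  have hJ0 : 0 ≤ b * (∫ s in (0:ℝ)..T, w s) - (w T * G T - g x) := by
    rw [← hJ, intervalIntegral.integral_of_le hT0]
    exact integral_nonneg_of_ae (hpt.mono fun s hs => hs.1)
  have hTT : T ∈ Icc 0 T := ⟨hT0, le_rfl⟩
  have hgx := hEG.g_ge_one x
  have hgT := hEG.g_ge_one (S.φ x T)
  have hGT : G T = g (S.φ x T) := hG T hTT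
  have hw0 : 0 ≤ ∫ s in (0:ℝ)..T, w s :=
    intervalIntegral.integral_nonneg hT0 fun s _ => (hwpos s).le
  calc _ ≤ ENNReal.ofReal (b * (∫ s in (0:ℝ)..T, w s) - (w T * G T - g x))
        + ENNReal.ofReal (w T * G T) := by
        rw [hw T hTT, ← ENNReal.ofReal_mul (hwpos T).le, ← hGT]
        exact add_le_add hlhs le_rfl
    _ = ENNReal.ofReal (g x + b * (∫ s in (0:ℝ)..T, w s)) := by
        rw [← ENNReal.ofReal_add hJ0 (by rw [hGT]; exact mul_nonneg (hwpos T).le (by linarith))]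
        congr 1; ring
    _ = _ := by
        rw [hwint, ENNReal.ofReal_add (by linarith) (mul_nonneg hEG.b_nonneg hw0),
          ENNReal.ofReal_mul hEG.b_nonneg]

lemma Gop_g_le (S : Setting n U) (hS : Basic S) {b c Kl : ℝ} {g Xg rbar lamL : (Fin n → ℝ) → ℝ}
    (hEG : ExpGrowth S b c g Xg rbar) (hLR : LowerRate S c lamL Kl) {x : Fin n → ℝ} (hx : x ∈ S.E)
    {Θ : RControl U} (hΘ : S.IsRelaxed x Θ) {α : ℝ} (hα : 0 ≤ α) :
    S.Gop α (fun z => ENNReal.ofReal (g z)) x Θ ≤ ENNReal.ofReal (g x + b * Kl) := by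
  have hgx := hEG.g_ge_one x
  have hC : ∀ T ∈ S.fs x, (∫⁻ t in Icc 0 T, S.weight α x Θ t *
        S.lamQMix (fun z => ENNReal.ofReal (g z)) (S.φ x t) (Θ.time t))
      + S.weight α x Θ T * ENNReal.ofReal (g (S.φ x T)) ≤ ENNReal.ofReal (g x + b * Kl) := by
    intro T hT
    refine (main_T S hS hEG hLR hx hΘ hT hα).trans ?_
    rw [ENNReal.ofReal_add (by linarith) (mul_nonneg hEG.b_nonneg hLR.Kl_nonneg),
      ENNReal.ofReal_mul hEG.b_nonneg]
    gcongr
    exact (lintegral_mono_set (fs_sub S hT)).trans (curlyL_le S hS hEG.c_pos hLR hx hΘ hα)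
  obtain ⟨T, hT, hU⟩ := lint_fs S hS hx (fun t => S.weight α x Θ t *
        S.lamQMix (fun z => ENNReal.ofReal (g z)) (S.φ x t) (Θ.time t))
  unfold Setting.Gop Setting.Lop
  rw [hU, ENNReal.iSup_add]
  refine iSup_le fun k => ?_
  unfold Setting.Hop
  by_cases h : S.ts x < ⊤
  · rw [if_pos h]
    have htp := tsR_pos S hS hx h
    have hcl : S.φ x (S.tsR x) ∈ closure S.E := by
      have hc : Continuous (fun t => S.φ x t) :=
        hS.contFlow.comp (by fun_prop : Continuous fun t : ℝ => (x, t))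
      have ht : Tendsto (fun t => S.φ x t) (𝓝[<] S.tsR x) (𝓝 (S.φ x (S.tsR x))) :=
        (hc.tendsto _).mono_left nhdsWithin_le_nhds
      refine mem_closure_of_tendsto ht ?_
      filter_upwards [Ioo_mem_nhdsLT htp] with t ht
      exact flow_mem S hS hx ((mem_fs_iff S h t).2 ⟨ht.1.le, ht.2⟩)
    have := hΘ.2.2.2.1
    have hQ : S.QMix (fun z => ENNReal.ofReal (g z)) (S.φ x (S.tsR x)) Θ.bdry
        ≤ ENNReal.ofReal (g (S.φ x (S.tsR x))) := by
      calc _ ≤ ∫⁻ _, ENNReal.ofReal (g (S.φ x (S.tsR x))) ∂Θ.bdry := by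
            apply lintegral_mono_ae
            filter_upwards [ae_feas_of_one (hS.feasCompact _ hcl).isClosed.measurableSet
              (hΘ.2.2.2.2 h)] with a ha
            exact le_add_self.trans (hEG.bdryGrowth x hx h a ha)
        _ = _ := by simp
    have hwne : S.weight α x Θ (S.tsR x) ≠ ⊤ := by
      unfold Setting.weight; split_ifs <;> simp
    have hlim : Tendsto (fun t => (∫⁻ t in Icc 0 (T k), S.weight α x Θ t *
        S.lamQMix (fun z => ENNReal.ofReal (g z)) (S.φ x t) (Θ.time t))
        + S.weight α x Θ (S.tsR x) * ENNReal.ofReal (g (S.φ x t))) (𝓝[<] S.tsR x)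
        (𝓝 ((∫⁻ t in Icc 0 (T k), S.weight α x Θ t *
        S.lamQMix (fun z => ENNReal.ofReal (g z)) (S.φ x t) (Θ.time t))
        + S.weight α x Θ (S.tsR x) * ENNReal.ofReal (g (S.φ x (S.tsR x))))) :=
      (ENNReal.Tendsto.const_mul (ENNReal.tendsto_ofReal (hEG.g_mac.2.2.2 x hx h))
        (Or.inr hwne)).const_add _
    have hTk := (mem_fs_iff S h _).1 (hT k)
    refine (add_le_add le_rfl (mul_le_mul_right hQ _)).trans (le_of_tendsto hlim ?_)
    filter_upwards [Ioo_mem_nhdsLT hTk.2] with t ht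
    have htm : t ∈ S.fs x := (mem_fs_iff S h t).2 ⟨hTk.1.trans ht.1.le, ht.2⟩
    refine le_trans ?_ (hC t htm)
    gcongr
    · exact ht.1.le
    · exact weight_anti S Θ hα ht.2.le
  · rw [if_neg h, add_zero]
    exact le_self_add.trans (hC _ (hT k))

lemma Gop_le_smul (S : Setting n U) (α N : ℝ) (hS : Basic S) (k k' : (Fin n → ℝ) → ℝ≥0∞)
    (hk : ∀ z ∈ S.E, k z ≤ ENNReal.ofReal N * k' z) (x : Fin n → ℝ) (Θ : RControl U) :
    S.Gop α k x Θ ≤ ENNReal.ofReal N * S.Gop α k' x Θ := by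
  have hQ : ∀ y a, S.Qpt k y a ≤ ENNReal.ofReal N * S.Qpt k' y a := by
    intro y a
    unfold Setting.Qpt
    rw [← lintegral_const_mul' _ _ ENNReal.ofReal_ne_top]
    exact setLIntegral_mono' hS.openE.measurableSet hk
  have h1 : ∀ y m, S.QMix k y m ≤ ENNReal.ofReal N * S.QMix k' y m := by
    intro y m
    unfold Setting.QMix
    rw [← lintegral_const_mul' _ _ ENNReal.ofReal_ne_top]
    exact lintegral_mono fun u => hQ y u
  have h2 : ∀ y m, S.lamQMix k y m ≤ ENNReal.ofReal N * S.lamQMix k' y m := by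
    intro y m
    unfold Setting.lamQMix
    rw [← lintegral_const_mul' _ _ ENNReal.ofReal_ne_top]
    refine lintegral_mono fun u => ?_
    rw [mul_left_comm]
    exact mul_le_mul_right (hQ y u) _
  unfold Setting.Gop
  rw [mul_add]
  apply add_le_add
  · unfold Setting.Lop
    rw [← lintegral_const_mul' _ _ ENNReal.ofReal_ne_top]
    refine lintegral_mono fun t => ?_
    dsimp only
    rw [mul_left_comm]
    exact mul_le_mul_right (h2 _ _) _
  · unfold Setting.Hop
    split_ifs
    · rw [mul_left_comm]
      exact mul_le_mul_right (h1 _ _) _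
    · simp

lemma oneStage_lower (S : Setting n U) (hS : Basic S) {b c Kl : ℝ} {g Xg rbar lamL : (Fin n → ℝ) → ℝ}
    (hEG : ExpGrowth S b c g Xg rbar) (hLR : LowerRate S c lamL Kl)
    (f r : (Fin n → ℝ) → U → ℝ) {x : Fin n → ℝ} (hx : x ∈ S.E)
    {Θ : RControl U} (hΘ : S.IsRelaxed x Θ) {α ρ : ℝ} (hα : 0 ≤ α) (hρ : 0 ≤ ρ)
    (h : (Fin n → ℝ) → ℝ) (hh : S.memBg h g) :
    ((-((ρ + b * S.gnorm h g) * Kl) - S.gnorm h g * g x : ℝ) : EReal)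
          ≤ S.oneStage α ρ f r h x Θ := by
  set N := S.gnorm h g with hN
  have hle : ∀ z ∈ S.E, |h z| ≤ N * g z := by
    intro z hz
    have hg := hEG.g_ge_one z
    have : |h z| / g z ≤ N := le_csSup hh.2 ⟨z, hz, rfl⟩
    rwa [div_le_iff₀ (by linarith)] at this
  have hgx := hEG.g_ge_one x
  have hN0 : 0 ≤ N := by
    have h1 := hle x hx
    have h2 := abs_nonneg (h x)
    by_contra hneg
    nlinarith [not_le.1 hneg]
  have hG1 : S.Gop α (fun z => ENNReal.ofReal (-h z)) x Θ
      ≤ ENNReal.ofReal (N * (g x + b * Kl)) := by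
    rw [ENNReal.ofReal_mul hN0]
    refine (Gop_le_smul S α N hS _ (fun z => ENNReal.ofReal (g z)) ?_ x Θ).trans
      (mul_le_mul_right (Gop_g_le S hS hEG hLR hx hΘ hα) _)
    intro z hz
    rw [← ENNReal.ofReal_mul hN0]
    exact ENNReal.ofReal_le_ofReal ((neg_le_abs _).trans (hle z hz))
  have hL := curlyL_le S hS hEG.c_pos hLR hx hΘ hα
  unfold Setting.oneStage Setting.GopS
  have hKl := hLR.Kl_nonneg
  have hb := hEG.b_nonneg
  have hC0 : 0 ≤ N * (g x + b * Kl) := mul_nonneg hN0 (by nlinarith [mul_nonneg hb hKl])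
  have e1 : ((-(ρ * Kl) : ℝ) : EReal) ≤ (-(ρ : EReal)) * ((S.curlyL α x Θ : ℝ≥0∞) : EReal) := by
    have hne : S.curlyL α x Θ ≠ ⊤ := ne_top_of_le_ne_top ENNReal.ofReal_ne_top hL
    have hr : (S.curlyL α x Θ).toReal ≤ Kl := ENNReal.toReal_le_of_le_ofReal hKl hL
    rw [← EReal.coe_ennreal_toReal hne, ← EReal.coe_neg, ← EReal.coe_mul, EReal.coe_le_coe_iff]
    nlinarith
  have e2 : ((-(N * (g x + b * Kl)) : ℝ) : EReal)
      ≤ ((S.Gop α (fun z => ENNReal.ofReal (h z)) x Θ : ℝ≥0∞) : EReal)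
    - ((S.Gop α (fun z => ENNReal.ofReal (-h z)) x Θ : ℝ≥0∞) : EReal) := by
    have hne := ne_top_of_le_ne_top ENNReal.ofReal_ne_top hG1
    have hr := ENNReal.toReal_le_of_le_ofReal hC0 hG1
    rw [← EReal.coe_ennreal_toReal hne, sub_eq_add_neg, ← EReal.coe_neg]
    calc ((-(N * (g x + b * Kl)) : ℝ) : EReal)
        ≤ 0 + ((-(S.Gop α (fun z => ENNReal.ofReal (-h z)) x Θ).toReal : ℝ) : EReal) := by
          rw [zero_add, EReal.coe_le_coe_iff]; linarith
      _ ≤ _ := add_le_add (EReal.coe_ennreal_nonneg _) le_rfl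
  calc ((-((ρ + b * N) * Kl) - N * g x : ℝ) : EReal)
      = ((-(ρ * Kl) : ℝ) : EReal) + 0 + 0 + ((-(N * (g x + b * Kl)) : ℝ) : EReal) := by
        rw [add_zero, add_zero, ← EReal.coe_add]; congr 1; ring
    _ ≤ _ := add_le_add (add_le_add (add_le_add e1 (EReal.coe_ennreal_nonneg _))
        (EReal.coe_ennreal_nonneg _)) e2

end main

/-- Inequality (Nw) of Lemma 3.13 of the paper: under the expected growth and lower-rate
conditions, for `α ≥ 0`, `ρ ≥ 0`, `h ∈ B_g(E)` and every relaxed control `Θ ∈ V^r(x)`,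
`-ρ𝓛_α + L_α f + H_α r + G_α h ≥ -(ρ + b‖h‖_g)K_λ - ‖h‖_g g(x)`; in particular the relaxed
one-stage value `R_α(ρ,h)(x)` satisfies the same lower bound. -/
theorem lemma_3_13_Nw {n : ℕ} {U : Type*} [MeasurableSpace U] [MetricSpace U]
    [CompactSpace U] [BorelSpace U]
    (S : Setting n U) (hS : Basic S)
    (b c : ℝ) (g Xg rbar lamL : (Fin n → ℝ) → ℝ) (Kl : ℝ)
    (hEG : ExpGrowth S b c g Xg rbar) (hLR : LowerRate S c lamL Kl)
    (f r : (Fin n → ℝ) → U → ℝ)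
    (hf_meas : Measurable (Function.uncurry f)) (hf_nonneg : ∀ y ∈ closure S.E, ∀ a, 0 ≤ f y a)
    (hr_meas : Measurable (Function.uncurry r)) (hr_nonneg : ∀ z ∈ frontier S.E, ∀ a, 0 ≤ r z a)
    (α ρ : ℝ) (hα : 0 ≤ α) (hρ : 0 ≤ ρ)
    (h : (Fin n → ℝ) → ℝ) (hh : S.memBg h g)
    (x : Fin n → ℝ) (hx : x ∈ S.E) :
    (∀ Θ : RControl U, S.IsRelaxed x Θ →
        ((-((ρ + b * S.gnorm h g) * Kl) - S.gnorm h g * g x : ℝ) : EReal)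
          ≤ S.oneStage α ρ f r h x Θ) ∧
      ((-((ρ + b * S.gnorm h g) * Kl) - S.gnorm h g * g x : ℝ) : EReal)
        ≤ sInf {v : EReal | ∃ Θ : RControl U, S.IsRelaxed x Θ ∧ v = S.oneStage α ρ f r h x Θ} := by
  have key := fun (Θ : RControl U) (hΘ : S.IsRelaxed x Θ) =>
    oneStage_lower S hS hEG hLR f r hx hΘ hα hρ h hh
  refine ⟨key, le_sInf ?_⟩
  rintro v ⟨Θ, hΘ, rfl⟩
  exact key Θ hΘ
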